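/- arXiv:2407.04864 — 8 statements merged into one kernel-verified Lean document; each statement's English description precedes it below -/
import Mathlib

section
/- Let S and A be real normed vector spaces, T : S × A → S a map satisfying ‖T(s,a) − T(s',a')‖ ≤ Lp(‖s − s'‖ + ‖a − a'‖) for all s,s',a,a', r : S × A → ℝ a bounded reward satisfying |r(s,a) − r(s',a')| ≤ Lr(‖s − s'‖ + ‖a − a'‖), and γ ∈ (0,1) a discount factor. Let π₁, π₂ : S → A be Lπ-Lipschitz policies with γ·Lp·(1+Lπ) < 1, let s₀ ∈ S, and suppose ε := sup_{s ∈ S} ‖π₁(s) − π₂(s)‖ is finite. Then the residual term satisfies |Σ_{t≥0} γ^t ( A^{π₁}(s_t^{π₂}, π₂(s_t^{π₂})) − A^{π₁}(s_t^{π₁}, π₂(s_t^{π₁})) )| ≤ C·ε, where C = 2γ·Lr·Lp·(1+Lπ) / ((1−γ)·(1−γ·Lp·(1+Lπ))²). -/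
/-- Trajectory of a deterministic policy `π` from initial state `s₀`:
`s₀^π = s₀`, `s_{t+1}^π = T(s_t^π, π(s_t^π))`. -/
def traj {S A : Type*} (T : S × A → S) (π : S → A) (s₀ : S) : ℕ → S
  | 0 => s₀
  | n + 1 => T (traj T π s₀ n, π (traj T π s₀ n))

/-- State-action sequence underlying `Q^π(s,a)`:
`(x₀,a₀) = (s,a)`, `x_{t+1} = T(x_t,a_t)`, `a_{t+1} = π(x_{t+1})`. -/
def qtraj {S A : Type*} (T : S × A → S) (π : S → A) (sa : S × A) : ℕ → S × A
  | 0 => sa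
  | n + 1 => (T (qtraj T π sa n), π (T (qtraj T π sa n)))

/-- Action-value function `Q^π(s,a) = Σ_{t≥0} γ^t r(x_t, a_t)`. -/
noncomputable def Qval {S A : Type*} (T : S × A → S) (r : S × A → ℝ) (γ : ℝ)
    (π : S → A) (s : S) (a : A) : ℝ :=
  ∑' t : ℕ, γ ^ t * r (qtraj T π (s, a) t)

/-- Advantage function `A^π(s,a) = Q^π(s,a) − Q^π(s, π(s))`. -/
noncomputable def Adv {S A : Type*} (T : S × A → S) (r : S × A → ℝ) (γ : ℝ)
    (π : S → A) (s : S) (a : A) : ℝ :=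
  Qval T r γ π s a - Qval T r γ π s (π s)

theorem qtraj_diff {S A : Type*} [NormedAddCommGroup S] [NormedAddCommGroup A]
    (T : S × A → S) (Lp Lπ : ℝ) (hLp : 0 ≤ Lp) (hLπ : 0 ≤ Lπ)
    (hT : ∀ s s' : S, ∀ a a' : A, ‖T (s, a) - T (s', a')‖ ≤ Lp * (‖s - s'‖ + ‖a - a'‖))
    (π : S → A) (hπ : ∀ s s' : S, ‖π s - π s'‖ ≤ Lπ * ‖s - s'‖) (p q : S × A) (t : ℕ) :
    ‖(qtraj T π p t).1 - (qtraj T π q t).1‖ + ‖(qtraj T π p t).2 - (qtraj T π q t).2‖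
      ≤ (Lp * (1 + Lπ)) ^ t * (‖p.1 - q.1‖ + ‖p.2 - q.2‖) := by
  induction t with
  | zero => simp [qtraj]
  | succ n ih =>
    simp only [qtraj]
    have h1 := hT (qtraj T π p n).1 (qtraj T π q n).1 (qtraj T π p n).2 (qtraj T π q n).2
    have h2 := hπ (T (qtraj T π p n)) (T (qtraj T π q n))
    simp only [Prod.mk.eta] at h1
    have h3 := mul_le_mul_of_nonneg_left ih (show 0 ≤ Lp * (1 + Lπ) by positivity)
    have h4 := mul_le_mul_of_nonneg_left h1 (show 0 ≤ 1 + Lπ by positivity)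
    rw [pow_succ]
    linarith

theorem Qval_lip {S A : Type*} [NormedAddCommGroup S] [NormedAddCommGroup A]
    (T : S × A → S) (r : S × A → ℝ) (γ Lp Lr Lπ R : ℝ)
    (hLp : 0 ≤ Lp) (hLr : 0 ≤ Lr) (hLπ : 0 ≤ Lπ)
    (hT : ∀ s s' : S, ∀ a a' : A, ‖T (s, a) - T (s', a')‖ ≤ Lp * (‖s - s'‖ + ‖a - a'‖))
    (hrBound : ∀ s : S, ∀ a : A, |r (s, a)| ≤ R)
    (hrLip : ∀ s s' : S, ∀ a a' : A, |r (s, a) - r (s', a')| ≤ Lr * (‖s - s'‖ + ‖a - a'‖))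
    (hγ : γ ∈ Set.Ioo (0 : ℝ) 1)
    (π : S → A) (hπ : ∀ s s' : S, ‖π s - π s'‖ ≤ Lπ * ‖s - s'‖)
    (hcontract : γ * Lp * (1 + Lπ) < 1) (s s' : S) (a a' : A) :
    |Qval T r γ π s a - Qval T r γ π s' a'| ≤
      Lr / (1 - γ * Lp * (1 + Lπ)) * (‖s - s'‖ + ‖a - a'‖) := by
  obtain ⟨h0, h1⟩ := hγ
  have hs : ∀ p : S × A, Summable fun t : ℕ => γ ^ t * r (qtraj T π p t) := by
    intro p
    refine Summable.of_norm_bounded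
      ((summable_geometric_of_lt_one h0.le h1).mul_right R) fun t => ?_
    rw [norm_mul, Real.norm_eq_abs, Real.norm_eq_abs, abs_of_nonneg (pow_nonneg h0.le t)]
    exact mul_le_mul_of_nonneg_left (hrBound _ _) (pow_nonneg h0.le t)
  unfold Qval
  rw [← (hs _).tsum_sub (hs _), ← Real.norm_eq_abs]
  have hg := (hasSum_geometric_of_lt_one
    (show 0 ≤ γ * Lp * (1 + Lπ) by positivity) hcontract).mul_right
      (Lr * (‖s - s'‖ + ‖a - a'‖))
  have hb := tsum_of_norm_bounded hg
    (f := fun t => γ ^ t * r (qtraj T π (s, a) t) - γ ^ t * r (qtraj T π (s', a') t)) ?_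
  · refine hb.trans (le_of_eq ?_)
    rw [div_eq_mul_inv]; ring
  · intro t
    rw [← mul_sub, norm_mul, Real.norm_eq_abs, Real.norm_eq_abs,
      abs_of_nonneg (pow_nonneg h0.le t)]
    have e1 := hrLip (qtraj T π (s, a) t).1 (qtraj T π (s', a') t).1
      (qtraj T π (s, a) t).2 (qtraj T π (s', a') t).2
    have e2 := qtraj_diff T Lp Lπ hLp hLπ hT π hπ (s, a) (s', a') t
    simp only [Prod.mk.eta] at e1
    calc _ ≤ γ ^ t * (Lr * ((Lp * (1 + Lπ)) ^ t * (‖s - s'‖ + ‖a - a'‖))) := by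
            refine mul_le_mul_of_nonneg_left (e1.trans ?_) (pow_nonneg h0.le t)
            exact mul_le_mul_of_nonneg_left e2 hLr
      _ = _ := by rw [mul_assoc γ, mul_pow γ]; ring

/-- Residual bound for deterministic Lipschitz MDPs (Theorem 1 of the paper,
deterministic-dynamics instance):
`|Σ_{t≥0} γ^t (A^{π₁}(s_t^{π₂}, π₂(s_t^{π₂})) − A^{π₁}(s_t^{π₁}, π₂(s_t^{π₁})))| ≤ C ε`
where `ε = sup_s ‖π₁(s) − π₂(s)‖` and
`C = 2γ Lr Lp (1+Lπ) / ((1−γ)(1−γ Lp (1+Lπ))²)`. -/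
theorem residual_bound {S A : Type*} [NormedAddCommGroup S] [NormedSpace ℝ S]
    [NormedAddCommGroup A] [NormedSpace ℝ A]
    (T : S × A → S) (r : S × A → ℝ) (γ Lp Lr Lπ R ε : ℝ)
    (hLp : 0 ≤ Lp) (hLr : 0 ≤ Lr) (hLπ : 0 ≤ Lπ)
    (hT : ∀ s s' : S, ∀ a a' : A, ‖T (s, a) - T (s', a')‖ ≤ Lp * (‖s - s'‖ + ‖a - a'‖))
    (hrBound : ∀ s : S, ∀ a : A, |r (s, a)| ≤ R)
    (hrLip : ∀ s s' : S, ∀ a a' : A, |r (s, a) - r (s', a')| ≤ Lr * (‖s - s'‖ + ‖a - a'‖))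
    (hγ : γ ∈ Set.Ioo (0 : ℝ) 1)
    (π₁ π₂ : S → A)
    (hπ₁ : ∀ s s' : S, ‖π₁ s - π₁ s'‖ ≤ Lπ * ‖s - s'‖)
    (hπ₂ : ∀ s s' : S, ‖π₂ s - π₂ s'‖ ≤ Lπ * ‖s - s'‖)
    (hcontract : γ * Lp * (1 + Lπ) < 1)
    (s₀ : S)
    (hε : ∀ s : S, ‖π₁ s - π₂ s‖ ≤ ε) :
    |∑' t : ℕ, γ ^ t *
        (Adv T r γ π₁ (traj T π₂ s₀ t) (π₂ (traj T π₂ s₀ t)) -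
          Adv T r γ π₁ (traj T π₁ s₀ t) (π₂ (traj T π₁ s₀ t)))| ≤
      (2 * γ * Lr * Lp * (1 + Lπ) / ((1 - γ) * (1 - γ * Lp * (1 + Lπ)) ^ 2)) * ε := by
  have hγ' := hγ
  obtain ⟨h0, h1⟩ := hγ'
  have hε0 : 0 ≤ ε := (norm_nonneg _).trans (hε s₀)
  have hk : 0 < 1 - γ * Lp * (1 + Lπ) := by linarith
  have hg : 0 < 1 - γ := by linarith
  set δ : ℕ → ℝ := fun t => ‖traj T π₂ s₀ t - traj T π₁ s₀ t‖ with hδ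
  have hδs : ∀ t, δ (t + 1) ≤ Lp * (1 + Lπ) * δ t + Lp * ε := by
    intro t
    have e1 := hT (traj T π₂ s₀ t) (traj T π₁ s₀ t) (π₂ (traj T π₂ s₀ t)) (π₁ (traj T π₁ s₀ t))
    have e2 : ‖π₂ (traj T π₂ s₀ t) - π₁ (traj T π₁ s₀ t)‖ ≤ Lπ * δ t + ε := by
      have a1 := norm_sub_le_norm_sub_add_norm_sub (π₂ (traj T π₂ s₀ t))
        (π₂ (traj T π₁ s₀ t)) (π₁ (traj T π₁ s₀ t))
      have a2 := hε (traj T π₁ s₀ t)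
      rw [norm_sub_rev] at a2
      have a3 := hπ₂ (traj T π₂ s₀ t) (traj T π₁ s₀ t)
      simp only [hδ]
      linarith
    have e3 := mul_le_mul_of_nonneg_left e2 hLp
    simp only [hδ, traj] at e3 ⊢
    linarith
  set B : ℝ := γ * Lp * ε / ((1 - γ) * (1 - γ * Lp * (1 + Lπ))) with hB
  have hBe : γ * Lp * (1 + Lπ) * B + γ * Lp * ε * (1 - γ)⁻¹ = B := by
    have : B * (1 - γ * Lp * (1 + Lπ)) = γ * Lp * ε * (1 - γ)⁻¹ := by
      rw [hB]; field_simp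
    linarith
  have hB0 : 0 ≤ B := by positivity
  have hD : ∀ n, ∑ t ∈ Finset.range n, γ ^ t * δ t ≤ B := by
    intro n
    induction n with
    | zero => simpa using hB0
    | succ n ih =>
      rw [Finset.sum_range_succ']
      have z : δ 0 = 0 := by simp [hδ, traj]
      have hgs : ∑ t ∈ Finset.range n, γ ^ t ≤ (1 - γ)⁻¹ := by
        rw [← tsum_geometric_of_lt_one h0.le h1]
        exact (summable_geometric_of_lt_one h0.le h1).sum_le_tsum _
          fun i _ => pow_nonneg h0.le i
      have hst : ∑ t ∈ Finset.range n, γ ^ (t + 1) * δ (t + 1) ≤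
          γ * Lp * (1 + Lπ) * ∑ t ∈ Finset.range n, γ ^ t * δ t
            + γ * Lp * ε * ∑ t ∈ Finset.range n, γ ^ t := by
        rw [Finset.mul_sum, Finset.mul_sum, ← Finset.sum_add_distrib]
        refine Finset.sum_le_sum fun t _ => ?_
        have := mul_le_mul_of_nonneg_left (hδs t) (pow_nonneg h0.le (t + 1))
        rw [pow_succ] at this ⊢
        linarith
      have m1 := mul_le_mul_of_nonneg_left ih (show 0 ≤ γ * Lp * (1 + Lπ) by positivity)
      have m2 := mul_le_mul_of_nonneg_left hgs (show 0 ≤ γ * Lp * ε by positivity)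
      rw [z, mul_zero, add_zero]
      linarith
  have hnn : ∀ t, 0 ≤ γ ^ t * δ t := fun t => mul_nonneg (pow_nonneg h0.le t) (norm_nonneg _)
  have hsum : Summable fun t => γ ^ t * δ t := summable_of_sum_range_le hnn hD
  have hts : ∑' t, γ ^ t * δ t ≤ B := Real.tsum_le_of_sum_range_le hnn hD
  set K : ℝ := 2 * (Lr / (1 - γ * Lp * (1 + Lπ))) * (1 + Lπ) with hK
  have hK0 : 0 ≤ K := by positivity
  rw [← Real.norm_eq_abs]
  refine (tsum_of_norm_bounded (hsum.hasSum.mul_left K) fun t => ?_).trans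
    ((mul_le_mul_of_nonneg_left hts hK0).trans (le_of_eq ?_))
  · rw [norm_mul, Real.norm_eq_abs, Real.norm_eq_abs, abs_of_nonneg (pow_nonneg h0.le t)]
    have hQ := Qval_lip T r γ Lp Lr Lπ R hLp hLr hLπ hT hrBound hrLip hγ π₁ hπ₁ hcontract
      (traj T π₂ s₀ t) (traj T π₁ s₀ t)
    have q1 := hQ (π₂ (traj T π₂ s₀ t)) (π₂ (traj T π₁ s₀ t))
    have q2 := hQ (π₁ (traj T π₂ s₀ t)) (π₁ (traj T π₁ s₀ t))
    have hL : 0 ≤ Lr / (1 - γ * Lp * (1 + Lπ)) := by positivity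
    have p1 := mul_le_mul_of_nonneg_left (hπ₁ (traj T π₂ s₀ t) (traj T π₁ s₀ t)) hL
    have p2 := mul_le_mul_of_nonneg_left (hπ₂ (traj T π₂ s₀ t) (traj T π₁ s₀ t)) hL
    have hA : |Adv T r γ π₁ (traj T π₂ s₀ t) (π₂ (traj T π₂ s₀ t)) -
          Adv T r γ π₁ (traj T π₁ s₀ t) (π₂ (traj T π₁ s₀ t))| ≤ K * δ t := by
      unfold Adv
      simp only [hK, hδ]
      rw [abs_le] at q1 q2 ⊢
      constructor <;> linarith [q1.1, q1.2, q2.1, q2.2]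
    have := mul_le_mul_of_nonneg_left hA (pow_nonneg h0.le t)
    linarith
  · rw [hK, hB]
    field_simp
end

section
/- Let S and A be real normed vector spaces, γ ∈ (0,1), and θ : S →L A a continuous linear map inducing the policy π_θ(s) = θ s. Let (s_t)_{t≥0} be a sequence in S with ‖s_t‖ ≤ B for all t (the trajectory of π_θ). Let Q : S → A → ℝ be such that for every s, the function Q(s, ·) : A → ℝ is Fréchet differentiable on A with ‖D_a Q(s, a)‖ ≤ L for all a. Define the advantage mean function on continuous linear maps x : S →L A by m(x) = Σ_{t≥0} γ^t ( Q(s_t, x s_t) − Q(s_t, θ s_t) ). Then m is Fréchet differentiable at θ and its derivative is the continuous linear map H ↦ Σ_{t≥0} γ^t D_a Q(s_t, θ s_t)(H s_t); i.e., the gradient of the advantage mean function at the central point θ is the deterministic policy gradient. -/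
noncomputable def dpgTerm {S A : Type*}
    [NormedAddCommGroup S] [NormedSpace ℝ S] [NormedAddCommGroup A] [NormedSpace ℝ A]
    (c : ℝ) (q : A → ℝ) (v : S) (x : S →L[ℝ] A) : (S →L[ℝ] A) →L[ℝ] ℝ :=
  c • (fderiv ℝ q (x v)).comp (ContinuousLinearMap.apply ℝ A v)

theorem dpgTerm_apply {S A : Type*}
    [NormedAddCommGroup S] [NormedSpace ℝ S] [NormedAddCommGroup A] [NormedSpace ℝ A]
    (c : ℝ) (q : A → ℝ) (v : S) (x H : S →L[ℝ] A) :
    dpgTerm c q v x H = c * fderiv ℝ q (x v) (H v) := rfl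

theorem dpgTerm_hasFDerivAt {S A : Type*}
    [NormedAddCommGroup S] [NormedSpace ℝ S] [NormedAddCommGroup A] [NormedSpace ℝ A]
    (c k : ℝ) (q : A → ℝ) (hq : Differentiable ℝ q) (v : S) (x : S →L[ℝ] A) :
    HasFDerivAt (fun x : S →L[ℝ] A => c * (q (x v) - k)) (dpgTerm c q v x) x := by
  have h1 : HasFDerivAt (fun y : S →L[ℝ] A => y v)
      (ContinuousLinearMap.apply ℝ A v) x :=
    (ContinuousLinearMap.apply ℝ A v).hasFDerivAt
  have h2 : HasFDerivAt q (fderiv ℝ q (x v)) (x v) := (hq (x v)).hasFDerivAt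
  have h3 : HasFDerivAt (fun y : S →L[ℝ] A => q (y v)) _ x := HasFDerivAt.comp x h2 h1
  exact (h3.sub_const k).const_mul c

theorem dpgTerm_norm_le {S A : Type*}
    [NormedAddCommGroup S] [NormedSpace ℝ S] [NormedAddCommGroup A] [NormedSpace ℝ A]
    (c B L : ℝ) (hc : 0 ≤ c) (q : A → ℝ) (hq : ∀ a, ‖fderiv ℝ q a‖ ≤ L) (v : S)
    (hv : ‖v‖ ≤ B) (x : S →L[ℝ] A) : ‖dpgTerm c q v x‖ ≤ c * (L * B) := by
  have hL : 0 ≤ L := (norm_nonneg _).trans (hq 0)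
  have hB0 : 0 ≤ B := (norm_nonneg _).trans hv
  refine ContinuousLinearMap.opNorm_le_bound _ (by positivity) fun H => ?_
  have h3 : ‖fderiv ℝ q (x v) (H v)‖ ≤ L * (‖H‖ * B) :=
    (ContinuousLinearMap.le_of_opNorm_le _ (hq _) _).trans
      (mul_le_mul_of_nonneg_left (H.le_opNorm_of_le hv) hL)
  rw [dpgTerm_apply, norm_mul, Real.norm_of_nonneg hc]
  calc c * ‖fderiv ℝ q (x v) (H v)‖ ≤ c * (L * (‖H‖ * B)) := mul_le_mul_of_nonneg_left h3 hc
    _ = c * (L * B) * ‖H‖ := by ring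

theorem dual_series_hasFDerivAt {E : Type*} [NormedAddCommGroup E] [NormedSpace ℝ E]
    (f : ℕ → E → ℝ) (f' : ℕ → E → E →L[ℝ] ℝ) (u : ℕ → ℝ) (x₀ : E) (hu : Summable u)
    (hf : ∀ n x, HasFDerivAt (f n) (f' n x) x) (hf' : ∀ n x, ‖f' n x‖ ≤ u n)
    (hf0 : Summable fun n => f n x₀) :
    ∃ D : E →L[ℝ] ℝ, (∀ H, D H = ∑' n, f' n x₀ H) ∧
      HasFDerivAt (fun y => ∑' n, f n y) D x₀ := by
  have hsum : Summable (fun n => f' n x₀) := Summable.of_norm_bounded hu fun n => hf' n x₀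
  exact ⟨∑' n, f' n x₀, fun H => (ContinuousLinearMap.apply ℝ ℝ H).map_tsum hsum,
    hasFDerivAt_tsum (x₀ := x₀) hu hf hf' hf0 x₀⟩

/-- The gradient of the advantage mean function at the central point `θ` is the
deterministic policy gradient (core identity of Corollary 1 of the paper):
with `m(x) = Σ_{t≥0} γ^t (Q(s_t, x s_t) − Q(s_t, θ s_t))`, the map `m` is Fréchet
differentiable at `θ` with derivative `H ↦ Σ_{t≥0} γ^t D_a Q(s_t, θ s_t)(H s_t)`. -/
theorem advantage_mean_gradient_is_dpg {S A : Type*}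
    [NormedAddCommGroup S] [NormedSpace ℝ S] [NormedAddCommGroup A] [NormedSpace ℝ A]
    (γ B L : ℝ) (hγ : γ ∈ Set.Ioo (0 : ℝ) 1)
    (θ : S →L[ℝ] A) (s : ℕ → S) (hB : ∀ t : ℕ, ‖s t‖ ≤ B)
    (Q : S → A → ℝ)
    (hQdiff : ∀ σ : S, Differentiable ℝ (Q σ))
    (hQgrad : ∀ σ : S, ∀ a : A, ‖fderiv ℝ (Q σ) a‖ ≤ L) :
    ∃ D : (S →L[ℝ] A) →L[ℝ] ℝ,
      (∀ H : S →L[ℝ] A, D H = ∑' t : ℕ, γ ^ t * fderiv ℝ (Q (s t)) (θ (s t)) (H (s t))) ∧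
      HasFDerivAt (fun x : S →L[ℝ] A => ∑' t : ℕ, γ ^ t * (Q (s t) (x (s t)) - Q (s t) (θ (s t))))
        D θ := by
  have hγ0 : 0 < γ := hγ.1
  have hγ1 : γ < 1 := hγ.2
  have hu : Summable (fun t : ℕ => γ ^ t * (L * B)) :=
    (summable_geometric_of_lt_one hγ0.le hγ1).mul_right _
  have hf' : ∀ (t : ℕ) (x : S →L[ℝ] A),
      ‖dpgTerm (γ ^ t) (Q (s t)) (s t) x‖ ≤ γ ^ t * (L * B) := fun t x =>
    dpgTerm_norm_le _ B L (pow_nonneg hγ0.le t) _ (hQgrad (s t)) _ (hB t) x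
  have hf0 : Summable fun t : ℕ => γ ^ t * (Q (s t) (θ (s t)) - Q (s t) (θ (s t))) := by
    simp only [sub_self, mul_zero]
    exact summable_zero
  exact dual_series_hasFDerivAt
    (fun t (x : S →L[ℝ] A) => γ ^ t * (Q (s t) (x (s t)) - Q (s t) (θ (s t))))
    (fun t x => dpgTerm (γ ^ t) (Q (s t)) (s t) x) (fun t => γ ^ t * (L * B)) θ hu
    (fun t x => dpgTerm_hasFDerivAt (γ ^ t) (Q (s t) (θ (s t))) (Q (s t)) (hQdiff (s t)) (s t) x)
    hf' hf0
end

section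
/- Let S and A be real normed vector spaces, T : S × A → S a map satisfying ‖T(s,a) − T(s',a')‖ ≤ Lp(‖s − s'‖ + ‖a − a'‖) for all s,s',a,a', and μ a Borel probability measure on S. Let π₁, π₂ : S → A be continuous policies with ε := sup_{s ∈ S} ‖π₁(s) − π₂(s)‖ finite, and let f : S → ℝ be 1-Lipschitz with s ↦ f(T(s, π₁(s))) integrable with respect to μ. Then s ↦ f(T(s, π₂(s))) is also μ-integrable and |∫ f(T(s, π₁(s))) dμ(s) − ∫ f(T(s, π₂(s))) dμ(s)| ≤ Lp·ε. -/
open MeasureTheory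

/-- Deterministic-dynamics, dual form of Part 1 of Theorem A.1 of the paper:
Lipschitzness of the one-step state distribution with respect to the policy.
For a 1-Lipschitz test function `f`, the integrals of `f` against the pushforwards
of `μ` by `s ↦ T(s, πᵢ(s))` differ by at most `Lp · ε` where
`ε = sup_s ‖π₁(s) − π₂(s)‖`. -/
theorem one_step_lipschitz_in_policy {S A : Type*}
    [NormedAddCommGroup S] [NormedSpace ℝ S] [NormedAddCommGroup A] [NormedSpace ℝ A]
    [MeasurableSpace S] [BorelSpace S]
    (T : S × A → S) (Lp ε : ℝ) (hLp : 0 ≤ Lp)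
    (hT : ∀ s s' : S, ∀ a a' : A, ‖T (s, a) - T (s', a')‖ ≤ Lp * (‖s - s'‖ + ‖a - a'‖))
    (μ : Measure S) [IsProbabilityMeasure μ]
    (π₁ π₂ : S → A) (hπ₁ : Continuous π₁) (hπ₂ : Continuous π₂)
    (hε : ∀ s : S, ‖π₁ s - π₂ s‖ ≤ ε)
    (f : S → ℝ) (hf : LipschitzWith 1 f)
    (hint : Integrable (fun s => f (T (s, π₁ s))) μ) :
    Integrable (fun s => f (T (s, π₂ s))) μ ∧
      |(∫ s, f (T (s, π₁ s)) ∂μ) - ∫ s, f (T (s, π₂ s)) ∂μ| ≤ Lp * ε := by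
  have hTc : Continuous T := by
    refine LipschitzWith.continuous (K := Real.toNNReal (Lp * 2))
      (LipschitzWith.of_dist_le_mul fun x y => ?_)
    rw [Real.coe_toNNReal _ (by positivity), dist_eq_norm, mul_assoc]
    refine (hT x.1 y.1 x.2 y.2).trans (mul_le_mul_of_nonneg_left ?_ hLp)
    have h1 : ‖x.1 - y.1‖ ≤ dist x y := by
      rw [← dist_eq_norm, Prod.dist_eq]; exact le_max_left _ _
    have h2 : ‖x.2 - y.2‖ ≤ dist x y := by
      rw [← dist_eq_norm, Prod.dist_eq]; exact le_max_right _ _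
    linarith
  have hb : ∀ s, ‖f (T (s, π₁ s)) - f (T (s, π₂ s))‖ ≤ Lp * ε := by
    intro s
    have h1 := hf.dist_le_mul (T (s, π₁ s)) (T (s, π₂ s))
    rw [dist_eq_norm, dist_eq_norm, NNReal.coe_one, one_mul] at h1
    have h2 := hT s s (π₁ s) (π₂ s)
    rw [sub_self, norm_zero, zero_add] at h2
    exact h1.trans (h2.trans (mul_le_mul_of_nonneg_left (hε s) hLp))
  have hc : ∀ p : S → A, Continuous p → Continuous (fun s => f (T (s, p s))) :=
    fun p hp => hf.continuous.comp (hTc.comp (continuous_id.prodMk hp))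
  have hd : Integrable (fun s => f (T (s, π₁ s)) - f (T (s, π₂ s))) μ :=
    Integrable.of_bound ((hc π₁ hπ₁).sub (hc π₂ hπ₂)).aestronglyMeasurable (Lp * ε)
      (Filter.Eventually.of_forall hb)
  have hi : Integrable (fun s => f (T (s, π₂ s))) μ := by
    have := hint.sub hd
    refine this.congr (Filter.Eventually.of_forall fun s => ?_)
    simp
  refine ⟨hi, ?_⟩
  rw [← integral_sub hint hi, ← Real.norm_eq_abs]
  have := norm_integral_le_of_norm_le_const (μ := μ) (Filter.Eventually.of_forall hb)
  simpa using this
end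

section
/- Let S and A be real normed vector spaces, T : S × A → S a map satisfying ‖T(s,a) − T(s',a')‖ ≤ Lp(‖s − s'‖ + ‖a − a'‖) for all s,s',a,a', r : S × A → ℝ a reward satisfying |r(s,a)| ≤ R and |r(s,a) − r(s',a')| ≤ Lr(‖s − s'‖ + ‖a − a'‖) for all s,s',a,a', and γ ∈ (0,1). Let π : S → A be an Lπ-Lipschitz policy with γ·Lp·(1+Lπ) < 1. Then the action-value function Q^π is jointly Lipschitz: for all s, s' ∈ S and a, a' ∈ A, |Q^π(s,a) − Q^π(s',a')| ≤ L_Q·(‖s − s'‖ + ‖a − a'‖), where L_Q = Lr / (1 − γ·Lp·(1+Lπ)). -/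
/-- Lipschitzness of the action-value function for deterministic Lipschitz MDPs
(Step 3 of the proof of Theorem 1 of the paper):
`|Q^π(s,a) − Q^π(s',a')| ≤ L_Q (‖s−s'‖ + ‖a−a'‖)` with
`L_Q = Lr / (1 − γ Lp (1+Lπ))`. -/
theorem Qval_lipschitz {S A : Type*}
    [NormedAddCommGroup S] [NormedSpace ℝ S] [NormedAddCommGroup A] [NormedSpace ℝ A]
    (T : S × A → S) (r : S × A → ℝ) (γ Lp Lr Lπ R : ℝ)
    (hLp : 0 ≤ Lp) (hLr : 0 ≤ Lr) (hLπ : 0 ≤ Lπ)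
    (hT : ∀ s s' : S, ∀ a a' : A, ‖T (s, a) - T (s', a')‖ ≤ Lp * (‖s - s'‖ + ‖a - a'‖))
    (hrBound : ∀ s : S, ∀ a : A, |r (s, a)| ≤ R)
    (hrLip : ∀ s s' : S, ∀ a a' : A, |r (s, a) - r (s', a')| ≤ Lr * (‖s - s'‖ + ‖a - a'‖))
    (hγ : γ ∈ Set.Ioo (0 : ℝ) 1)
    (π : S → A) (hπ : ∀ s s' : S, ‖π s - π s'‖ ≤ Lπ * ‖s - s'‖)
    (hcontract : γ * Lp * (1 + Lπ) < 1) :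
    ∀ s s' : S, ∀ a a' : A,
      |Qval T r γ π s a - Qval T r γ π s' a'| ≤
        (Lr / (1 - γ * Lp * (1 + Lπ))) * (‖s - s'‖ + ‖a - a'‖) := by
  intro s s' a a'
  obtain ⟨hγ0, hγ1⟩ := hγ
  have hk0 : 0 ≤ γ * Lp * (1 + Lπ) := by positivity
  have hd : ∀ t : ℕ, ‖(qtraj T π (s, a) t).1 - (qtraj T π (s', a') t).1‖
      + ‖(qtraj T π (s, a) t).2 - (qtraj T π (s', a') t).2‖
      ≤ (Lp * (1 + Lπ)) ^ t * (‖s - s'‖ + ‖a - a'‖) := by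
    intro t
    induction t with
    | zero => simp [qtraj]
    | succ n ih =>
      have h1 := hT (qtraj T π (s, a) n).1 (qtraj T π (s', a') n).1
        (qtraj T π (s, a) n).2 (qtraj T π (s', a') n).2
      have h2 := hπ (T (qtraj T π (s, a) n)) (T (qtraj T π (s', a') n))
      simp only [Prod.mk.eta] at h1
      simp only [qtraj]
      calc _ ≤ (1 + Lπ) * ‖T (qtraj T π (s, a) n) - T (qtraj T π (s', a') n)‖ := by linarith
        _ ≤ (1 + Lπ) * (Lp * ((Lp * (1 + Lπ)) ^ n * (‖s - s'‖ + ‖a - a'‖))) := by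
          gcongr
          exact h1.trans (by gcongr)
        _ = _ := by ring
  have hs : ∀ p : S × A, Summable fun t : ℕ => γ ^ t * r (qtraj T π p t) := by
    intro p
    refine Summable.of_norm_bounded
      ((summable_geometric_of_lt_one hγ0.le hγ1).mul_right R) fun t => ?_
    rw [Real.norm_eq_abs, abs_mul, abs_of_nonneg (pow_nonneg hγ0.le t)]
    exact mul_le_mul_of_nonneg_left (hrBound _ _) (pow_nonneg hγ0.le t)
  have hg := (hasSum_geometric_of_lt_one hk0 hcontract).mul_left
    (Lr * (‖s - s'‖ + ‖a - a'‖))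
  unfold Qval
  rw [← (hs _).tsum_sub (hs _), ← Real.norm_eq_abs]
  refine (tsum_of_norm_bounded hg fun t => ?_).trans (le_of_eq (by ring))
  rw [← mul_sub, Real.norm_eq_abs, abs_mul, abs_of_nonneg (pow_nonneg hγ0.le t)]
  calc _ ≤ γ ^ t * (Lr * ((Lp * (1 + Lπ)) ^ t * (‖s - s'‖ + ‖a - a'‖))) := by
        gcongr
        exact (hrLip _ _ _ _).trans (mul_le_mul_of_nonneg_left (hd t) hLr)
    _ = _ := by rw [mul_assoc γ, mul_pow γ]; ring
end

section
/- Let S and A be real normed vector spaces, T : S × A → S a map satisfying ‖T(s,a) − T(s',a')‖ ≤ Lp(‖s − s'‖ + ‖a − a'‖), r : S × A → ℝ a reward satisfying |r(s,a)| ≤ R and |r(s,a) − r(s',a')| ≤ Lr(‖s − s'‖ + ‖a − a'‖), and γ ∈ (0,1). Let π₁ and π₂ both be Lπ-Lipschitz policies with γ·Lp·(1+Lπ) < 1. Then the map s ↦ Q^{π₁}(s, π₂(s)) is Lipschitz with constant L_Q·(1+Lπ), where L_Q = Lr / (1 − γ·Lp·(1+Lπ)). In particular (taking π₂ = π₁),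 the value function V^{π₁}(s) = Q^{π₁}(s, π₁(s)) is L_Q·(1+Lπ)-Lipschitz. -/
/-- Lipschitzness of the policy-composed action-value function
(ingredient of Steps 2–4 of the proof of Theorem 1 of the paper):
the map `s ↦ Q^{π₁}(s, π₂(s))` is `L_Q(1+Lπ)`-Lipschitz, with
`L_Q = Lr / (1 − γ Lp (1+Lπ))`. In particular (`π₂ = π₁`), the value
function `V^{π₁}` is `L_Q(1+Lπ)`-Lipschitz. -/
theorem Qval_policy_composed_lipschitz {S A : Type*}
    [NormedAddCommGroup S] [NormedSpace ℝ S] [NormedAddCommGroup A] [NormedSpace ℝ A]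
    (T : S × A → S) (r : S × A → ℝ) (γ Lp Lr Lπ R : ℝ)
    (hLp : 0 ≤ Lp) (hLr : 0 ≤ Lr) (hLπ : 0 ≤ Lπ)
    (hT : ∀ s s' : S, ∀ a a' : A, ‖T (s, a) - T (s', a')‖ ≤ Lp * (‖s - s'‖ + ‖a - a'‖))
    (hrBound : ∀ s : S, ∀ a : A, |r (s, a)| ≤ R)
    (hrLip : ∀ s s' : S, ∀ a a' : A, |r (s, a) - r (s', a')| ≤ Lr * (‖s - s'‖ + ‖a - a'‖))
    (hγ : γ ∈ Set.Ioo (0 : ℝ) 1)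
    (π₁ π₂ : S → A)
    (hπ₁ : ∀ s s' : S, ‖π₁ s - π₁ s'‖ ≤ Lπ * ‖s - s'‖)
    (hπ₂ : ∀ s s' : S, ‖π₂ s - π₂ s'‖ ≤ Lπ * ‖s - s'‖)
    (hcontract : γ * Lp * (1 + Lπ) < 1) :
    ∀ s s' : S,
      |Qval T r γ π₁ s (π₂ s) - Qval T r γ π₁ s' (π₂ s')| ≤
        (Lr / (1 - γ * Lp * (1 + Lπ))) * (1 + Lπ) * ‖s - s'‖ := by
  intro s s'
  obtain ⟨hγ0, hγ1⟩ := hγ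
  have hD : ∀ n : ℕ,
      ‖(qtraj T π₁ (s, π₂ s) n).1 - (qtraj T π₁ (s', π₂ s') n).1‖ +
        ‖(qtraj T π₁ (s, π₂ s) n).2 - (qtraj T π₁ (s', π₂ s') n).2‖ ≤
      (Lp * (1 + Lπ)) ^ n * ((1 + Lπ) * ‖s - s'‖) := by
    intro n
    induction n with
    | zero =>
      have h := hπ₂ s s'
      simp only [qtraj, pow_zero]
      linarith
    | succ k ih =>
      have h1 := hT (qtraj T π₁ (s, π₂ s) k).1 (qtraj T π₁ (s', π₂ s') k).1
        (qtraj T π₁ (s, π₂ s) k).2 (qtraj T π₁ (s', π₂ s') k).2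
      have h2 := hπ₁ (T (qtraj T π₁ (s, π₂ s) k)) (T (qtraj T π₁ (s', π₂ s') k))
      have h3 := h1.trans (mul_le_mul_of_nonneg_left ih hLp)
      simp only [Prod.mk.eta] at h3
      have h4 := mul_le_mul_of_nonneg_left h3 (by linarith : 0 ≤ 1 + Lπ)
      simp only [qtraj]
      rw [pow_succ]
      linarith
  have hsum : ∀ p : S × A, Summable fun t : ℕ => γ ^ t * r (qtraj T π₁ p t) := by
    intro p
    refine Summable.of_norm_bounded
      (g := fun t : ℕ => γ ^ t * R)
      ((summable_geometric_of_lt_one hγ0.le hγ1).mul_right R) ?_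
    intro t
    rw [norm_mul, Real.norm_eq_abs, Real.norm_eq_abs, abs_of_nonneg (pow_nonneg hγ0.le t)]
    exact mul_le_mul_of_nonneg_left (hrBound _ _) (pow_nonneg hγ0.le t)
  have hq0 : 0 ≤ γ * Lp * (1 + Lπ) := by positivity
  have hg := (hasSum_geometric_of_lt_one hq0 hcontract).mul_right (Lr * ((1 + Lπ) * ‖s - s'‖))
  unfold Qval
  rw [← (hsum _).tsum_sub (hsum _), ← Real.norm_eq_abs]
  refine (tsum_of_norm_bounded hg ?_).trans (le_of_eq (by ring))
  intro t
  rw [← mul_sub, norm_mul, Real.norm_eq_abs, Real.norm_eq_abs,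
    abs_of_nonneg (pow_nonneg hγ0.le t)]
  have h1 := hrLip (qtraj T π₁ (s, π₂ s) t).1 (qtraj T π₁ (s', π₂ s') t).1
    (qtraj T π₁ (s, π₂ s) t).2 (qtraj T π₁ (s', π₂ s') t).2
  have h2 := h1.trans (mul_le_mul_of_nonneg_left (hD t) hLr)
  refine (mul_le_mul_of_nonneg_left h2 (pow_nonneg hγ0.le t)).trans (le_of_eq ?_)
  rw [mul_assoc γ, mul_pow γ]
  ring
end

section
/- Let S and A be real normed vector spaces, T : S × A → S a map satisfying ‖T(s,a) − T(s',a')‖ ≤ Lp(‖s − s'‖ + ‖a − a'‖), r : S × A → ℝ a reward satisfying |r(s,a)| ≤ R and |r(s,a) − r(s',a')| ≤ Lr(‖s − s'‖ + ‖a − a'‖), and γ ∈ (0,1). Let π₁ and π₂ both be Lπ-Lipschitz policies with γ·Lp·(1+Lπ) < 1. Then the map s ↦ A^{π₁}(s, π₂(s)) = Q^{π₁}(s, π₂(s)) − Q^{π₁}(s, π₁(s)) is Lipschitz with constant 2·L_Q·(1+Lπ), where L_Q = Lr / (1 − γ·Lp·(1+Lπ)). -/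
theorem qtraj_dist_le {S A : Type*}
    [NormedAddCommGroup S] [NormedAddCommGroup A]
    (T : S × A → S) (Lp Lπ : ℝ) (hLp : 0 ≤ Lp) (hLπ : 0 ≤ Lπ)
    (hT : ∀ s s' : S, ∀ a a' : A, ‖T (s, a) - T (s', a')‖ ≤ Lp * (‖s - s'‖ + ‖a - a'‖))
    (π : S → A) (hπ : ∀ s s' : S, ‖π s - π s'‖ ≤ Lπ * ‖s - s'‖) (p q : S × A) (n : ℕ) :
    ‖(qtraj T π p n).1 - (qtraj T π q n).1‖ + ‖(qtraj T π p n).2 - (qtraj T π q n).2‖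
      ≤ (Lp * (1 + Lπ)) ^ n * (‖p.1 - q.1‖ + ‖p.2 - q.2‖) := by
  induction n with
  | zero => simp [qtraj]
  | succ n ih =>
    have h1 := hT (qtraj T π p n).1 (qtraj T π q n).1 (qtraj T π p n).2 (qtraj T π q n).2
    have h2 := hπ (T (qtraj T π p n)) (T (qtraj T π q n))
    simp only [Prod.mk.eta] at h1
    simp only [qtraj]
    calc _ ≤ (1 + Lπ) * ‖T (qtraj T π p n) - T (qtraj T π q n)‖ := by linarith
      _ ≤ (1 + Lπ) * (Lp * ((Lp * (1 + Lπ)) ^ n * (‖p.1 - q.1‖ + ‖p.2 - q.2‖))) := by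
        gcongr
        exact h1.trans (by gcongr)
      _ = _ := by ring

/-- Lipschitzness of the policy-composed advantage function
(combined conclusion of Steps 2–4 of the proof of Theorem 1 of the paper):
the map `s ↦ A^{π₁}(s, π₂(s))` is `2 L_Q (1+Lπ)`-Lipschitz, with
`L_Q = Lr / (1 − γ Lp (1+Lπ))`. -/
theorem Adv_policy_composed_lipschitz {S A : Type*}
    [NormedAddCommGroup S] [NormedSpace ℝ S] [NormedAddCommGroup A] [NormedSpace ℝ A]
    (T : S × A → S) (r : S × A → ℝ) (γ Lp Lr Lπ R : ℝ)
    (hLp : 0 ≤ Lp) (hLr : 0 ≤ Lr) (hLπ : 0 ≤ Lπ)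
    (hT : ∀ s s' : S, ∀ a a' : A, ‖T (s, a) - T (s', a')‖ ≤ Lp * (‖s - s'‖ + ‖a - a'‖))
    (hrBound : ∀ s : S, ∀ a : A, |r (s, a)| ≤ R)
    (hrLip : ∀ s s' : S, ∀ a a' : A, |r (s, a) - r (s', a')| ≤ Lr * (‖s - s'‖ + ‖a - a'‖))
    (hγ : γ ∈ Set.Ioo (0 : ℝ) 1)
    (π₁ π₂ : S → A)
    (hπ₁ : ∀ s s' : S, ‖π₁ s - π₁ s'‖ ≤ Lπ * ‖s - s'‖)
    (hπ₂ : ∀ s s' : S, ‖π₂ s - π₂ s'‖ ≤ Lπ * ‖s - s'‖)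
    (hcontract : γ * Lp * (1 + Lπ) < 1) :
    ∀ s s' : S,
      |Adv T r γ π₁ s (π₂ s) - Adv T r γ π₁ s' (π₂ s')| ≤
        2 * (Lr / (1 - γ * Lp * (1 + Lπ))) * (1 + Lπ) * ‖s - s'‖ := by
  intro s s'
  have q := Qval_lip T r γ Lp Lr Lπ R hLp hLr hLπ hT hrBound hrLip hγ π₁ hπ₁ hcontract s s'
  have hL : 0 ≤ Lr / (1 - γ * Lp * (1 + Lπ)) := div_nonneg hLr (by linarith)
  have q2 := q (π₂ s) (π₂ s')
  have q1 := q (π₁ s) (π₁ s')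
  have b2 := mul_le_mul_of_nonneg_left (hπ₂ s s') hL
  have b1 := mul_le_mul_of_nonneg_left (hπ₁ s s') hL
  unfold Adv
  rw [abs_le] at *
  constructor <;> nlinarith
end

section
/- Let S and A be real normed vector spaces, T : S × A → S a map satisfying ‖T(s,a) − T(s',a')‖ ≤ Lp(‖s − s'‖ + ‖a − a'‖) for all s,s',a,a'. Let π₁ : S → A be an Lπ-Lipschitz policy, π₂ : S → A any policy, and suppose ε := sup_{s ∈ S} ‖π₁(s) − π₂(s)‖ is finite. Fix s₀ ∈ S and let s_t^{π₁}, s_t^{π₂} denote the respective trajectories from s₀. Then for every t ≥ 0, ‖s_t^{π₁} − s_t^{π₂}‖ ≤ Lp·ε · Σ_{k=0}^{t−1} (Lp·(1+Lπ))^k. -/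
/-- Trajectory-divergence bound (intermediate claim of Step 5 of the proof of
Theorem 1 of the paper): for every `t`,
`‖s_t^{π₁} − s_t^{π₂}‖ ≤ Lp ε Σ_{k=0}^{t−1} (Lp (1+Lπ))^k`
where `ε = sup_s ‖π₁(s) − π₂(s)‖`. -/
theorem trajectory_divergence {S A : Type*}
    [NormedAddCommGroup S] [NormedSpace ℝ S] [NormedAddCommGroup A] [NormedSpace ℝ A]
    (T : S × A → S) (Lp Lπ ε : ℝ) (hLp : 0 ≤ Lp) (hLπ : 0 ≤ Lπ)
    (hT : ∀ s s' : S, ∀ a a' : A, ‖T (s, a) - T (s', a')‖ ≤ Lp * (‖s - s'‖ + ‖a - a'‖))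
    (π₁ π₂ : S → A)
    (hπ₁ : ∀ s s' : S, ‖π₁ s - π₁ s'‖ ≤ Lπ * ‖s - s'‖)
    (hε : ∀ s : S, ‖π₁ s - π₂ s‖ ≤ ε)
    (s₀ : S) :
    ∀ t : ℕ, ‖traj T π₁ s₀ t - traj T π₂ s₀ t‖ ≤
      Lp * ε * ∑ k ∈ Finset.range t, (Lp * (1 + Lπ)) ^ k := by
  intro t
  induction t with
  | zero => simp [traj]
  | succ n ih =>
    rw [Finset.sum_range_succ']
    simp only [traj, pow_succ, pow_zero, ← Finset.sum_mul]
    generalize traj T π₁ s₀ n = x at *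
    generalize traj T π₂ s₀ n = y at *
    generalize ∑ k ∈ Finset.range n, (Lp * (1 + Lπ)) ^ k = c at *
    have h1 : ‖π₁ x - π₂ y‖ ≤ Lπ * ‖x - y‖ + ε :=
      (norm_sub_le_norm_sub_add_norm_sub _ (π₁ y) _).trans (add_le_add (hπ₁ x y) (hε y))
    calc ‖T (x, π₁ x) - T (y, π₂ y)‖ ≤ Lp * (‖x - y‖ + ‖π₁ x - π₂ y‖) := hT _ _ _ _
      _ ≤ Lp * (‖x - y‖ + (Lπ * ‖x - y‖ + ε)) := by gcongr
      _ = Lp * (1 + Lπ) * ‖x - y‖ + Lp * ε := by ring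
      _ ≤ Lp * (1 + Lπ) * (Lp * ε * c) + Lp * ε := by gcongr
      _ = _ := by ring
end

section
/- Let S and A be real normed vector spaces, T : S × A → S a map satisfying ‖T(s,a) − T(s',a')‖ ≤ Lp(‖s − s'‖ + ‖a − a'‖), π₁ : S → A an Lπ-Lipschitz policy, π₂ : S → A any policy with ε := sup_{s ∈ S} ‖π₁(s) − π₂(s)‖ finite, γ ∈ (0,1) with γ·Lp·(1+Lπ) < 1, and s₀ ∈ S. Then for every L_f-Lipschitz function f : S → ℝ, the series Σ_{t≥0} γ^t ( f(s_t^{π₂}) − f(s_t^{π₁}) ) converges absolutely and |Σ_{t≥0} γ^t ( f(s_t^{π₂}) − f(s_t^{π₁}) )| ≤ L_f · γ·Lp·ε / ((1−γ)·(1 − γ·Lp·(1+Lπ))). -/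
/-- Discounted-occupancy difference bound for Lipschitz test functions
(deterministic-dynamics form of the occupancy Wasserstein bound in Step 5 of the
proof of Theorem 1 of the paper): the series
`Σ_{t≥0} γ^t (f(s_t^{π₂}) − f(s_t^{π₁}))` converges absolutely and
`|Σ_{t≥0} γ^t (f(s_t^{π₂}) − f(s_t^{π₁}))| ≤ L_f γ Lp ε / ((1−γ)(1 − γ Lp (1+Lπ)))`. -/
theorem occupancy_difference_bound {S A : Type*}
    [NormedAddCommGroup S] [NormedSpace ℝ S] [NormedAddCommGroup A] [NormedSpace ℝ A]
    (T : S × A → S) (Lp Lπ γ ε Lf : ℝ) (hLp : 0 ≤ Lp) (hLπ : 0 ≤ Lπ) (hLf : 0 ≤ Lf)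
    (hT : ∀ s s' : S, ∀ a a' : A, ‖T (s, a) - T (s', a')‖ ≤ Lp * (‖s - s'‖ + ‖a - a'‖))
    (π₁ π₂ : S → A)
    (hπ₁ : ∀ s s' : S, ‖π₁ s - π₁ s'‖ ≤ Lπ * ‖s - s'‖)
    (hε : ∀ s : S, ‖π₁ s - π₂ s‖ ≤ ε)
    (hγ : γ ∈ Set.Ioo (0 : ℝ) 1)
    (hcontract : γ * Lp * (1 + Lπ) < 1)
    (s₀ : S)
    (f : S → ℝ) (hf : ∀ s s' : S, |f s - f s'| ≤ Lf * ‖s - s'‖) :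
    Summable (fun t : ℕ => |γ ^ t * (f (traj T π₂ s₀ t) - f (traj T π₁ s₀ t))|) ∧
      |∑' t : ℕ, γ ^ t * (f (traj T π₂ s₀ t) - f (traj T π₁ s₀ t))| ≤
        Lf * γ * Lp * ε / ((1 - γ) * (1 - γ * Lp * (1 + Lπ))) := by
  obtain ⟨hγ0, hγ1⟩ := hγ
  have hε0 : 0 ≤ ε := (norm_nonneg _).trans (hε s₀)
  set q := γ * Lp * (1 + Lπ) with hq
  have hq0 : 0 ≤ q := by positivity
  set d : ℕ → ℝ := fun t => ‖traj T π₂ s₀ t - traj T π₁ s₀ t‖ with hd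
  have hd0 : d 0 = 0 := by simp [hd, traj]
  have hdn : ∀ t, d (t + 1) ≤ Lp * (1 + Lπ) * d t + Lp * ε := by
    intro t
    have h1 := hT (traj T π₂ s₀ t) (traj T π₁ s₀ t) (π₂ (traj T π₂ s₀ t)) (π₁ (traj T π₁ s₀ t))
    have h2 := hπ₁ (traj T π₂ s₀ t) (traj T π₁ s₀ t)
    have h3 := hε (traj T π₂ s₀ t)
    rw [norm_sub_rev] at h3
    have h4 := norm_sub_le_norm_sub_add_norm_sub (π₂ (traj T π₂ s₀ t)) (π₁ (traj T π₂ s₀ t))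
      (π₁ (traj T π₁ s₀ t))
    have h5 : ‖π₂ (traj T π₂ s₀ t) - π₁ (traj T π₁ s₀ t)‖ ≤ ε + Lπ * d t := by
      simp only [hd]; linarith
    have h6 : d (t + 1) ≤ Lp * (d t + (ε + Lπ * d t)) :=
      h1.trans (mul_le_mul_of_nonneg_left (by simp only [hd] at h5 ⊢; linarith) hLp)
    linarith
  have h1γ : 0 < 1 - γ := by linarith
  have h1q : 0 < 1 - q := by linarith
  set C := γ * Lp * ε / (1 - γ) with hC
  have hC0 : 0 ≤ C := by positivity
  have hgeo : ∀ n, ∑ t ∈ Finset.range n, γ ^ t ≤ 1 / (1 - γ) := by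
    intro n
    have h := (summable_geometric_of_lt_one hγ0.le hγ1).sum_le_tsum (Finset.range n)
      (fun i _ => pow_nonneg hγ0.le i)
    rw [tsum_geometric_of_lt_one hγ0.le hγ1] at h
    simpa using h
  have hE : ∀ n, ∑ t ∈ Finset.range n, γ ^ t * d t ≤ C / (1 - q) := by
    intro n
    induction n with
    | zero => simp; positivity
    | succ n ih =>
      rw [Finset.sum_range_succ', hd0]
      have h1 : ∑ t ∈ Finset.range n, γ ^ (t + 1) * d (t + 1) ≤
          ∑ t ∈ Finset.range n, (q * (γ ^ t * d t) + γ * Lp * ε * γ ^ t) := by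
        refine Finset.sum_le_sum fun t _ => ?_
        have := mul_le_mul_of_nonneg_left (hdn t) (pow_nonneg hγ0.le (t + 1))
        refine this.trans (le_of_eq ?_)
        rw [hq]; ring
      rw [Finset.sum_add_distrib, ← Finset.mul_sum, ← Finset.mul_sum] at h1
      have h2 := mul_le_mul_of_nonneg_left ih hq0
      have h3 := mul_le_mul_of_nonneg_left (hgeo n) (show 0 ≤ γ * Lp * ε by positivity)
      have h4 : γ * Lp * ε * (1 / (1 - γ)) = C := by rw [hC]; ring
      have h5 : q * (C / (1 - q)) + C = C / (1 - q) := by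
        field_simp; ring
      linarith
  have hG : ∀ n, ∑ t ∈ Finset.range n,
      |γ ^ t * (f (traj T π₂ s₀ t) - f (traj T π₁ s₀ t))| ≤ Lf * (C / (1 - q)) := by
    intro n
    refine le_trans ?_ (mul_le_mul_of_nonneg_left (hE n) hLf)
    rw [Finset.mul_sum]
    refine Finset.sum_le_sum fun t _ => ?_
    rw [abs_mul, abs_of_nonneg (pow_nonneg hγ0.le t)]
    refine (mul_le_mul_of_nonneg_left (hf _ _) (pow_nonneg hγ0.le t)).trans (le_of_eq ?_)
    simp only [hd]; ring
  have hS := summable_of_sum_range_le (fun t => abs_nonneg _) hG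
  refine ⟨hS, ?_⟩
  have hB : Lf * γ * Lp * ε / ((1 - γ) * (1 - q)) = Lf * (C / (1 - q)) := by
    rw [hC]; field_simp
  rw [hB]
  have h1 := norm_tsum_le_tsum_norm (f := fun t : ℕ =>
    γ ^ t * (f (traj T π₂ s₀ t) - f (traj T π₁ s₀ t))) (by simpa only [Real.norm_eq_abs] using hS)
  simp only [Real.norm_eq_abs] at h1
  exact h1.trans (Real.tsum_le_of_sum_range_le (fun t => abs_nonneg _) hG)
end
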